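/- arXiv:2502.06497 — 2 statements merged into one kernel-verified Lean document; each statement's English description precedes it below -/
import Mathlib

section
/- (From the proofs of Proposition 3.10 and Proposition 3.13: regular-value property of φ12 in the 3-1 type case.) Let Q12(l) = [(c23² + c12² + c13² + 2·c23·c12·c13 − 1)·(e^{2l24} + 2e^{l24+l14}·c12 + e^{2l14})]^{1/2}, which does not depend on l34. For every l = (l12, l13, l14, l23, l24, l34) ∈ ℝ^6, the function t ↦ φ12(l12, l13, l14, l23, l24, t) is differentiable at t = l34 with derivative −e^{l34}·sinh²(l12) / Q12(l); in particular, this partial derivative is strictly negative whenever l12 ≠ 0. -/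
open Real

/-- Extended angle-cosine `φ₁₂` of a decorated 3-1 type hyperbolic tetrahedron
(vertices 1,2,3 hyper-ideal, vertex 4 ideal), with `(i,j,k) = (1,2,3)`. -/
noncomputable def phi12 (l12 l13 l14 l23 l24 l34 : ℝ) : ℝ :=
  ((exp l24 + exp l14 * cosh l12) * (cosh l23 + cosh l12 * cosh l13)
      - (exp l34 + exp l14 * cosh l13) * (sinh l12) ^ 2) /
    Real.sqrt (((cosh l23) ^ 2 + (cosh l12) ^ 2 + (cosh l13) ^ 2
        + 2 * cosh l23 * cosh l12 * cosh l13 - 1) *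
      (exp (2 * l24) + 2 * exp (l24 + l14) * cosh l12 + exp (2 * l14)))

/-- The denominator `Q₁₂` of `φ₁₂` in the 3-1 type case; it does not depend on `l34`. -/
noncomputable def Q12 (l12 l13 l14 l23 l24 : ℝ) : ℝ :=
  Real.sqrt (((cosh l23) ^ 2 + (cosh l12) ^ 2 + (cosh l13) ^ 2
      + 2 * cosh l23 * cosh l12 * cosh l13 - 1) *
    (exp (2 * l24) + 2 * exp (l24 + l14) * cosh l12 + exp (2 * l14)))

theorem Q12_pos (l12 l13 l14 l23 l24 : ℝ) : 0 < Q12 l12 l13 l14 l23 l24 := by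
  refine Real.sqrt_pos.mpr (mul_pos ?_ ?_)
  · have h12 : 1 ≤ cosh l12 ^ 2 := one_le_pow₀ (one_le_cosh l12)
    have := cosh_pos l12
    have := cosh_pos l13
    have := cosh_pos l23
    have : 0 < cosh l23 ^ 2 + cosh l13 ^ 2 + 2 * cosh l23 * cosh l12 * cosh l13 := by
      positivity
    linarith
  · have := cosh_pos l12
    positivity

/-- Regular-value property of `φ₁₂` in the 3-1 type case (from the proofs of
Propositions 3.10 and 3.13): `∂φ₁₂/∂l34 = −e^{l34} sinh² l12 / Q₁₂(l)`, which is
strictly negative whenever `l12 ≠ 0`. -/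
theorem phi12_hasDerivAt_l34_31 (l12 l13 l14 l23 l24 l34 : ℝ) :
    HasDerivAt (fun t => phi12 l12 l13 l14 l23 l24 t)
      (-exp l34 * (sinh l12) ^ 2 / Q12 l12 l13 l14 l23 l24) l34 ∧
    (l12 ≠ 0 → -exp l34 * (sinh l12) ^ 2 / Q12 l12 l13 l14 l23 l24 < 0) := by
  refine ⟨?_, fun h => ?_⟩
  · have h := ((hasDerivAt_const l34
        ((exp l24 + exp l14 * cosh l12) * (cosh l23 + cosh l12 * cosh l13))).sub
      (((Real.hasDerivAt_exp l34).add_const (exp l14 * cosh l13)).mul_const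
        (sinh l12 ^ 2))).div_const (Q12 l12 l13 l14 l23 l24)
    rw [zero_sub, ← neg_mul] at h
    exact h
  · have hs : 0 < sinh l12 ^ 2 := sq_pos_of_ne_zero (Real.sinh_ne_zero.mpr h)
    rw [neg_mul, neg_div]
    exact neg_lt_zero.mpr (div_pos (mul_pos (exp_pos _) hs) (Q12_pos ..))
end

section
/- (Lemma 3.5: φ14 agrees with the Euclidean cosine law on the horosphere at the ideal vertex 4 of a 3-1 type tetrahedron.) For every l = (l12, l13, l14, l23, l24, l34) ∈ ℝ^6, set u = √(2·(cosh l12 + cosh(l14 − l24))/e^{l14+l24}), v = √(2·(cosh l13 + cosh(l14 − l34))/e^{l14+l34}), and w² = 2·(cosh l23 + cosh(l24 − l34))/e^{l24+l34} (these are θ12⁴, θ13⁴ and (θ23⁴)², the Euclidean side lengths of the horospherical triangle at v4). Then φ14(l) = (u² + v² − w²) / (2·u·v). -/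
open Real

/-- Extended angle-cosine `φ₁₄` of a decorated 3-1 type hyperbolic tetrahedron
(vertices 1,2,3 hyper-ideal, vertex 4 ideal), with `(i,j,k) = (1,2,3)`. -/
noncomputable def phi14 (l12 l13 l14 l23 l24 l34 : ℝ) : ℝ :=
  (exp l24 * exp l34
      + exp l14 * (exp l34 * cosh l12 + exp l24 * cosh l13 - exp l14 * cosh l23)) /
    Real.sqrt ((exp (2 * l24) + 2 * exp (l24 + l14) * cosh l12 + exp (2 * l14)) *
      (exp (2 * l34) + 2 * exp (l34 + l14) * cosh l13 + exp (2 * l14)))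

/-- The squared Euclidean length of a horospherical edge, as a rational function of exponentials. -/
lemma two_mul_add_cosh_sub_div_exp_add (x p q : ℝ) :
    2 * (x + cosh (p - q)) / exp (p + q) =
      (exp (2 * q) + 2 * exp (q + p) * x + exp (2 * p)) / (exp p * exp q) ^ 2 := by
  have hp := exp_ne_zero p
  have hq := exp_ne_zero q
  rw [cosh_eq, neg_sub, exp_sub, exp_sub, two_mul q, two_mul p]
  simp only [exp_add]
  field_simp
  ring

lemma exp_add_two_mul_exp_mul_cosh_add_exp_pos (x p q : ℝ) :
    0 < exp (2 * q) + 2 * exp (q + p) * cosh x + exp (2 * p) := by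
  have := cosh_pos x
  positivity

/-- Lemma 3.5: `φ₁₄` agrees with the Euclidean cosine law on the horosphere at the
ideal vertex `v₄` of a 3-1 type tetrahedron: with `u = θ₁₂⁴`, `v = θ₁₃⁴` and
`w2 = (θ₂₃⁴)²` as below, one has `φ₁₄(l) = (u² + v² − w²)/(2·u·v)`. -/
theorem phi14_eq_euclidean_cosine_law (l12 l13 l14 l23 l24 l34 : ℝ)
    (u v w2 : ℝ)
    (hu : u = Real.sqrt (2 * (cosh l12 + cosh (l14 - l24)) / exp (l14 + l24)))
    (hv : v = Real.sqrt (2 * (cosh l13 + cosh (l14 - l34)) / exp (l14 + l34)))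
    (hw : w2 = 2 * (cosh l23 + cosh (l24 - l34)) / exp (l24 + l34)) :
    phi14 l12 l13 l14 l23 l24 l34 = (u ^ 2 + v ^ 2 - w2) / (2 * u * v) := by
  have hP := exp_add_two_mul_exp_mul_cosh_add_exp_pos l12 l14 l24
  have hQ := exp_add_two_mul_exp_mul_cosh_add_exp_pos l13 l14 l34
  rw [two_mul_add_cosh_sub_div_exp_add] at hu hv hw
  rw [sqrt_div hP.le, sqrt_sq (by positivity)] at hu
  rw [sqrt_div hQ.le, sqrt_sq (by positivity)] at hv
  rw [phi14, sqrt_mul hP.le, hu, hv, hw, div_pow, div_pow, sq_sqrt hP.le, sq_sqrt hQ.le]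
  have hP' := (sqrt_pos.mpr hP).ne'
  have hQ' := (sqrt_pos.mpr hQ).ne'
  generalize √(exp (2 * l24) + 2 * exp (l24 + l14) * cosh l12 + exp (2 * l14)) = r at *
  generalize √(exp (2 * l34) + 2 * exp (l34 + l14) * cosh l13 + exp (2 * l14)) = t at *
  have ha := exp_ne_zero l14
  have hb := exp_ne_zero l24
  have hc := exp_ne_zero l34
  simp only [two_mul l14, two_mul l24, two_mul l34, exp_add]
  field_simp
  ring
end
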